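/- arXiv:2512.04101 — 5 statements merged into one kernel-verified Lean document; each statement's English description precedes it below -/
import Mathlib

section
/- Let n ≥ 1, let Ω ⊆ ℝⁿ be a bounded open set, and let f₊, f₋ : ℝⁿ → ℝⁿ be maps that are C² on an open neighborhood of the closure of Ω and satisfy f₊(x) = f₋(x) for every x in the topological boundary ∂Ω. Then ∫_Ω det(Df₊(x)) dx = ∫_Ω det(Df₋(x)) dx, where Df denotes the Fréchet derivative (Jacobian matrix) and the integrals are with respect to Lebesgue measure. -/
open MeasureTheory

open scoped NNReal Topology

/-- A line segment from an open set to its complement meets the frontier of the set. -/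
theorem exists_mem_segment_mem_frontier {E : Type*} [AddCommGroup E] [Module ℝ E]
    [TopologicalSpace E] [ContinuousAdd E] [ContinuousSMul ℝ E] {s : Set E} (hs : IsOpen s)
    {x y : E} (hx : x ∈ s) (hy : y ∉ s) : ∃ z ∈ segment ℝ x y, z ∈ frontier s := by
  by_contra! h
  have hcover : segment ℝ x y ⊆ s ∪ (closure s)ᶜ := by
    intro z hz
    by_cases hzs : z ∈ s
    · exact Or.inl hzs
    · exact Or.inr fun hzc => h z hz (hs.frontier_eq ▸ ⟨hzc, hzs⟩)
  have hsub : segment ℝ x y ⊆ s :=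
    IsPreconnected.subset_left_of_subset_union hs isClosed_closure.isOpen_compl
      (Set.disjoint_left.2 fun z hz hzc => hzc (subset_closure hz)) hcover
      ⟨x, left_mem_segment ℝ x y, hx⟩ (convex_segment x y).isPreconnected
  exact hy (hsub (right_mem_segment ℝ x y))

/-- A map that is Lipschitz on the closure of an open set and on its complement is Lipschitz. -/
theorem LipschitzOnWith.lipschitzWith_of_closure_compl {E F : Type*} [NormedAddCommGroup E]
    [NormedSpace ℝ E] [PseudoMetricSpace F] {s : Set E} (hs : IsOpen s) {K : ℝ≥0} {f : E → F}
    (hf : LipschitzOnWith K f (closure s)) (hf' : LipschitzOnWith K f sᶜ) :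
    LipschitzWith K f := by
  have cross : ∀ x ∈ s, ∀ y ∉ s, dist (f x) (f y) ≤ K * dist x y := by
    intro x hx y hy
    obtain ⟨z, hz, hzf⟩ := exists_mem_segment_mem_frontier hs hx hy
    have hzs : z ∉ s := (hs.frontier_eq ▸ hzf).2
    calc dist (f x) (f y) ≤ dist (f x) (f z) + dist (f z) (f y) := dist_triangle _ _ _
      _ ≤ K * dist x z + K * dist z y :=
        add_le_add (hf.dist_le_mul x (subset_closure hx) z hzf.1) (hf'.dist_le_mul z hzs y hy)
      _ = K * dist x y := by rw [← mul_add, dist_add_dist_of_mem_segment hz]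
  refine LipschitzWith.of_dist_le_mul fun x y => ?_
  by_cases hx : x ∈ s <;> by_cases hy : y ∈ s
  · exact hf.dist_le_mul x (subset_closure hx) y (subset_closure hy)
  · exact cross x hx y hy
  · simpa only [dist_comm] using cross y hy x hx
  · exact hf'.dist_le_mul x hx y hy

/-- Two bijections that agree off a set have the same image of that set. -/
theorem Function.Bijective.image_eq_image_of_eqOn_compl {α β : Type*} {f g : α → β} {s : Set α}
    (hf : Function.Bijective f) (hg : Function.Bijective g) (h : Set.EqOn f g sᶜ) :
    f '' s = g '' s := by
  rw [← compl_inj_iff, ← Set.image_compl_eq hf, ← Set.image_compl_eq hg, h.image_eq]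

/-- A Lipschitz map becomes bijective after adding a large enough multiple of the identity. -/
theorem LipschitzWith.bijective_smul_add {E : Type*} [NormedAddCommGroup E] [NormedSpace ℝ E]
    [CompleteSpace E] {K : ℝ≥0} {f : E → E} (hf : LipschitzWith K f) {t : ℝ} (ht : K < t) :
    Function.Bijective fun x => t • x + f x := by
  have ht0 : 0 < t := K.coe_nonneg.trans_lt ht
  let e : E ≃L[ℝ] E := ContinuousLinearEquiv.smulLeft (Units.mk0 t ht0.ne')
  have hfe : ApproximatesLinearOn (fun x => t • x + f x) (e : E →L[ℝ] E) Set.univ K := by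
    intro x _ y _
    have : t • x + f x - (t • y + f y) - e (x - y) = f x - f y := by
      change t • x + f x - (t • y + f y) - t • (x - y) = _
      rw [smul_sub]
      abel
    simpa only [ContinuousLinearEquiv.coe_coe, this] using hf.norm_sub_le x y
  have hc : Subsingleton E ∨ K < ‖(e.symm : E →L[ℝ] E)‖₊⁻¹ := by
    rcases subsingleton_or_nontrivial E with hE | hE
    · exact Or.inl hE
    · right
      have hsymm : (e.symm : E →L[ℝ] E) = t⁻¹ • ContinuousLinearMap.id ℝ E := by
        ext x
        rfl
      rw [← NNReal.coe_lt_coe]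
      simpa [hsymm, norm_smul, abs_of_pos ht0] using ht
  exact (hfe.toHomeomorph _ hc).bijective

/-- `t • 1 + A` has positive determinant when `t` exceeds the norm of `A`. -/
theorem ContinuousLinearMap.det_smul_id_add_pos {E : Type*} [NormedAddCommGroup E]
    [NormedSpace ℝ E] [FiniteDimensional ℝ E] (A : E →L[ℝ] E) {t : ℝ} (ht : ‖A‖ < t) :
    0 < (t • ContinuousLinearMap.id ℝ E + A).det := by
  have ht0 : 0 < t := (norm_nonneg A).trans_lt ht
  let φ : ℝ → ℝ := fun r => (t • ContinuousLinearMap.id ℝ E + r • A).det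
  have hφ : Continuous φ := ContinuousLinearMap.continuous_det.comp (by fun_prop)
  have hφ0 : 0 < φ 0 := by
    simp only [φ, zero_smul, add_zero, ContinuousLinearMap.det, ContinuousLinearMap.toLinearMap_smul,
      LinearMap.det_smul, ContinuousLinearMap.coe_id, LinearMap.det_id, mul_one]
    positivity
  have hne : ∀ r ∈ Set.Icc (0 : ℝ) 1, φ r ≠ 0 := by
    intro r hr h0
    have hker := LinearMap.bot_lt_ker_of_det_eq_zero h0
    obtain ⟨v, hv, hv0⟩ := (Submodule.ne_bot_iff _).1 hker.ne'
    have hv : t • v + r • A v = 0 := by simpa using hv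
    have hnorm : t * ‖v‖ = r * ‖A v‖ := by
      have := congrArg norm (eq_neg_of_add_eq_zero_left hv)
      rwa [norm_neg, norm_smul, norm_smul, Real.norm_of_nonneg ht0.le,
        Real.norm_of_nonneg hr.1] at this
    have hv' : 0 < ‖v‖ := norm_pos_iff.2 hv0
    have h1 : r * ‖A v‖ ≤ 1 * (‖A‖ * ‖v‖) :=
      mul_le_mul hr.2 (A.le_opNorm v) (norm_nonneg _) zero_le_one
    nlinarith
  have hφ1 : φ 1 = (t • ContinuousLinearMap.id ℝ E + A).det := by simp only [φ, one_smul]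
  rw [← hφ1]
  by_contra! h
  obtain ⟨r, hr, hr0⟩ := intermediate_value_Icc' zero_le_one hφ.continuousOn ⟨h, hφ0.le⟩
  exact hne r hr hr0

/-- The determinant of `A` is a linear combination, with coefficients independent of `A`, of the
determinants of `t i • 1 + A`, for sufficiently many distinct `t i`. -/
theorem ContinuousLinearMap.det_eq_sum_basis_mul_det {E : Type*} [NormedAddCommGroup E]
    [NormedSpace ℝ E] [FiniteDimensional ℝ E] {ι : Type*} [DecidableEq ι] {s : Finset ι}
    {t : ι → ℝ} (ht : Set.InjOn t s) (hs : Module.finrank ℝ E < s.card) (A : E →L[ℝ] E) :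
    A.det = ∑ i ∈ s, (Lagrange.basis s t i).eval 0 *
      (t i • ContinuousLinearMap.id ℝ E + A).det := by
  let p := LinearMap.charpoly (-(A : E →ₗ[ℝ] E))
  have hp : ∀ r, p.eval r = (r • ContinuousLinearMap.id ℝ E + A).det := by
    intro r
    rw [LinearMap.eval_charpoly, sub_neg_eq_add]
    rfl
  have hdeg : p.degree < s.card := by
    refine Polynomial.degree_le_natDegree.trans_lt ?_
    rw [LinearMap.charpoly_natDegree]
    exact_mod_cast hs
  have h0 := congrArg (Polynomial.eval 0) (Lagrange.eq_interpolate ht hdeg)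
  rw [Lagrange.interpolate_apply, Polynomial.eval_finsetSum] at h0
  simp only [Polynomial.eval_mul, Polynomial.eval_C, hp, zero_smul, zero_add] at h0
  rw [h0]
  exact Finset.sum_congr rfl fun i _ => mul_comm _ _

section Integral

variable {E : Type*} [NormedAddCommGroup E] [NormedSpace ℝ E] [FiniteDimensional ℝ E]
  [MeasurableSpace E] [BorelSpace E]

/-- The Jacobian determinant of `x ↦ t • x + f x` is integrable on a set of finite measure on which
the derivative of `f` is bounded. -/
theorem integrableOn_det_smul_id_add_fderiv {μ : Measure E} {s : Set E} (hs : MeasurableSet s)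
    (hμ : μ s ≠ ⊤) {f : E → E} {C : ℝ} (hf : ∀ x ∈ s, ‖fderiv ℝ f x‖ ≤ C) (t : ℝ) :
    IntegrableOn (fun x => (t • ContinuousLinearMap.id ℝ E + fderiv ℝ f x).det) s μ := by
  have hdet : Continuous fun A : E →L[ℝ] E => (t • ContinuousLinearMap.id ℝ E + A).det :=
    ContinuousLinearMap.continuous_det.comp (by fun_prop)
  obtain ⟨M, hM⟩ := (isCompact_closedBall (0 : E →L[ℝ] E) C).exists_bound_of_continuousOn
    hdet.continuousOn
  refine Measure.integrableOn_of_bounded hμ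
    (hdet.measurable.comp (measurable_fderiv ℝ f)).aestronglyMeasurable (M := M) ?_
  filter_upwards [ae_restrict_mem hs] with x hx
  exact hM _ (mem_closedBall_zero_iff.2 (hf x hx))

/-- The integral over `s` of the Jacobian determinant of `x ↦ t • x + f x`, for `f` Lipschitz and
`t` large, is the volume of the image of `s`. -/
theorem LipschitzWith.setIntegral_det_smul_id_add_fderiv {μ : Measure E} [μ.IsAddHaarMeasure]
    {s : Set E} (hs : MeasurableSet s) {f : E → E} {K : ℝ≥0} (hf : LipschitzWith K f)
    (hdiff : ∀ x ∈ s, DifferentiableAt ℝ f x) {t : ℝ} (ht : K < t) :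
    ∫ x in s, (t • ContinuousLinearMap.id ℝ E + fderiv ℝ f x).det ∂μ =
      μ.real ((fun x => t • x + f x) '' s) := by
  have hcv := integral_image_eq_integral_abs_det_fderiv_smul μ hs
    (f := fun x => t • x + f x) (f' := fun x => t • ContinuousLinearMap.id ℝ E + fderiv ℝ f x)
    (fun x hx => (((hasFDerivAt_id x).const_smul t).add
      (hdiff x hx).hasFDerivAt).hasFDerivWithinAt)
    (hf.bijective_smul_add ht).injective.injOn (fun _ => (1 : ℝ))
  rw [setIntegral_const, smul_eq_mul, mul_one] at hcv
  rw [hcv]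
  refine setIntegral_congr_fun hs fun x _ => ?_
  have hpos := (fderiv ℝ f x).det_smul_id_add_pos
    ((norm_fderiv_le_of_lipschitz ℝ hf).trans_lt ht)
  simp only [abs_of_pos hpos, smul_eq_mul, mul_one]

/-- Lipschitz maps that agree off a set of finite measure, and are differentiable on it, have the
same integral of the Jacobian determinant over it. -/
theorem LipschitzWith.setIntegral_det_fderiv_eq {μ : Measure E} [μ.IsAddHaarMeasure]
    {s : Set E} (hs : MeasurableSet s) (hμ : μ s ≠ ⊤) {f g : E → E} {K : ℝ≥0}
    (hf : LipschitzWith K f) (hg : LipschitzWith K g)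
    (hfs : ∀ x ∈ s, DifferentiableAt ℝ f x) (hgs : ∀ x ∈ s, DifferentiableAt ℝ g x)
    (hfg : Set.EqOn f g sᶜ) :
    ∫ x in s, (fderiv ℝ f x).det ∂μ = ∫ x in s, (fderiv ℝ g x).det ∂μ := by
  let I := Finset.range (Module.finrank ℝ E + 1)
  let t : ℕ → ℝ := fun i => K + 1 + i
  have htinj : Set.InjOn t I := fun i _ j _ hij => by
    simpa only [t, add_right_inj, Nat.cast_inj] using hij
  have ht : ∀ i, K < t i := fun i => by
    have : (0 : ℝ) ≤ i := i.cast_nonneg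
    simp only [t]
    linarith
  have expand : ∀ h : E → E, LipschitzWith K h →
      ∫ x in s, (fderiv ℝ h x).det ∂μ = ∑ i ∈ I, (Lagrange.basis I t i).eval 0 *
        ∫ x in s, (t i • ContinuousLinearMap.id ℝ E + fderiv ℝ h x).det ∂μ := by
    intro h hh
    simp_rw [← integral_const_mul]
    rw [← integral_finsetSum]
    · exact integral_congr_ae (Filter.Eventually.of_forall fun x =>
        (fderiv ℝ h x).det_eq_sum_basis_mul_det htinj (by simp [I]))
    · exact fun i _ => (integrableOn_det_smul_id_add_fderiv hs hμ
        (fun x _ => norm_fderiv_le_of_lipschitz ℝ hh) (t i)).const_mul _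
  rw [expand f hf, expand g hg]
  refine Finset.sum_congr rfl fun i _ => ?_
  rw [hf.setIntegral_det_smul_id_add_fderiv hs hfs (ht i),
    hg.setIntegral_det_smul_id_add_fderiv hs hgs (ht i),
    (hf.bijective_smul_add (ht i)).image_eq_image_of_eqOn_compl (hg.bijective_smul_add (ht i))
      fun x hx => by simp only [hfg hx]]

end Integral

/-- A `C¹` map on an open set is Lipschitz on every compact subset. -/
theorem ContDiffOn.exists_lipschitzOnWith_of_isCompact_subset {E F : Type*}
    [NormedAddCommGroup E] [NormedSpace ℝ E] [NormedAddCommGroup F] [NormedSpace ℝ F]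
    {f : E → F} {U s : Set E} (hf : ContDiffOn ℝ 1 f U) (hU : IsOpen U) (hs : IsCompact s)
    (hsU : s ⊆ U) : ∃ K, LipschitzOnWith K f s := by
  refine LocallyLipschitzOn.exists_lipschitzOnWith_of_compact hs fun x hx => ?_
  obtain ⟨K, v, hv, hfv⟩ := (hf.contDiffAt (hU.mem_nhds (hsU hx))).exists_lipschitzOnWith
  exact ⟨K, v, mem_nhdsWithin_of_mem_nhds hv, hfv⟩

/-- The integral of the Jacobian determinant depends only on boundary values:
if `f₊` and `f₋` are `C²` on a neighborhood of the closure of a bounded open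
set `Ω ⊆ ℝⁿ` and agree on the boundary of `Ω`, then the integrals over `Ω` of
`det Df₊` and `det Df₋` coincide. -/
theorem integral_jacobian_det_eq_of_eqOn_frontier
    (n : ℕ) (hn : 1 ≤ n)
    (Ω : Set (EuclideanSpace ℝ (Fin n))) (hΩopen : IsOpen Ω)
    (hΩbdd : Bornology.IsBounded Ω)
    (fp fm : EuclideanSpace ℝ (Fin n) → EuclideanSpace ℝ (Fin n))
    (U : Set (EuclideanSpace ℝ (Fin n))) (hUopen : IsOpen U)
    (hΩU : closure Ω ⊆ U)
    (hfp : ContDiffOn ℝ 2 fp U) (hfm : ContDiffOn ℝ 2 fm U)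
    (hbd : ∀ x ∈ frontier Ω, fp x = fm x) :
    ∫ x in Ω, (fderiv ℝ fp x).det ∂volume = ∫ x in Ω, (fderiv ℝ fm x).det ∂volume := by
  classical
  have hcompact : IsCompact (closure Ω) := hΩbdd.isCompact_closure
  obtain ⟨Kp, hKp⟩ := (hfp.of_le one_le_two).exists_lipschitzOnWith_of_isCompact_subset
    hUopen hcompact hΩU
  obtain ⟨Km, hKm⟩ := (hfm.of_le one_le_two).exists_lipschitzOnWith_of_isCompact_subset
    hUopen hcompact hΩU
  obtain ⟨g, hg, hgm⟩ := hKm.extend_finite_dimension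
  let f := Ω.piecewise fp g
  have hfp_closure : Set.EqOn f fp (closure Ω) := by
    intro x hx
    by_cases hxΩ : x ∈ Ω
    · exact Set.piecewise_eq_of_mem _ _ _ hxΩ
    · rw [hbd x (hΩopen.frontier_eq ▸ ⟨hx, hxΩ⟩), hgm hx]
      exact Set.piecewise_eq_of_notMem _ _ _ hxΩ
  have hfg : Set.EqOn f g Ωᶜ := Set.piecewise_eqOn_compl Ω fp g
  set K := max Kp (lipschitzExtensionConstant (EuclideanSpace ℝ (Fin n)) * Km)
  have hgK : LipschitzWith K g := hg.weaken (le_max_right _ _)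
  have hfK : LipschitzWith K f := by
    refine LipschitzOnWith.lipschitzWith_of_closure_compl hΩopen ?_ ?_
    · intro x hx y hy
      rw [hfp_closure hx, hfp_closure hy]
      exact (hKp.weaken (le_max_left _ _)) hx hy
    · intro x hx y hy
      rw [hfg hx, hfg hy]
      exact hgK x y
  have hfe : ∀ x ∈ Ω, f =ᶠ[𝓝 x] fp := fun x hx =>
    (hfp_closure.mono subset_closure).eventuallyEq_of_mem (hΩopen.mem_nhds hx)
  have hge : ∀ x ∈ Ω, g =ᶠ[𝓝 x] fm := fun x hx =>
    (hgm.symm.mono subset_closure).eventuallyEq_of_mem (hΩopen.mem_nhds hx)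
  have hdiff : ∀ h : EuclideanSpace ℝ (Fin n) → EuclideanSpace ℝ (Fin n), ContDiffOn ℝ 2 h U →
      ∀ x ∈ Ω, DifferentiableAt ℝ h x := fun h hh x hx =>
    (hh.contDiffAt (hUopen.mem_nhds (hΩU (subset_closure hx)))).differentiableAt two_ne_zero
  have key := LipschitzWith.setIntegral_det_fderiv_eq (μ := volume) hΩopen.measurableSet
    hΩbdd.measure_lt_top.ne hfK hgK
    (fun x hx => (hfe x hx).differentiableAt_iff.2 (hdiff fp hfp x hx))
    (fun x hx => (hge x hx).differentiableAt_iff.2 (hdiff fm hfm x hx)) hfg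
  calc ∫ x in Ω, (fderiv ℝ fp x).det
      = ∫ x in Ω, (fderiv ℝ f x).det :=
        setIntegral_congr_fun hΩopen.measurableSet fun x hx => by simp only [(hfe x hx).fderiv_eq]
    _ = ∫ x in Ω, (fderiv ℝ g x).det := key
    _ = ∫ x in Ω, (fderiv ℝ fm x).det :=
        setIntegral_congr_fun hΩopen.measurableSet fun x hx => by simp only [(hge x hx).fderiv_eq]
end

section
/- Let n ≥ 1 and let B denote the closed unit ball in ℝⁿ. If f : ℝⁿ → ℝⁿ is C² on an open neighborhood of B and f(x) = x for every x in the unit sphere ∂B, then ∫_B det(Df(x)) dx = Vol(B), the Lebesgue measure of the closed unit ball. -/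
open MeasureTheory

/-- A preconnected set meeting both `s` and its complement meets the frontier of `s`. -/
theorem IsPreconnected.inter_frontier_nonempty {X : Type*} [TopologicalSpace X] {t s : Set X}
    (ht : IsPreconnected t) (h : (t ∩ s).Nonempty) (h' : (t ∩ sᶜ).Nonempty) :
    (t ∩ frontier s).Nonempty := by
  by_contra hne
  have hfr : ∀ x ∈ t, x ∈ closure s → x ∈ interior s := fun x hx hc => by
    by_contra hi
    exact hne ⟨x, hx, hc, hi⟩
  obtain ⟨x, hxt, hxs⟩ := h
  obtain ⟨y, hyt, hys⟩ := h'
  obtain ⟨z, -, hzi, hzc⟩ := ht (interior s) (closure s)ᶜ isOpen_interior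
    isClosed_closure.isOpen_compl
    (fun z hz => (em (z ∈ closure s)).imp (hfr z hz) id)
    ⟨x, hxt, hfr x hxt (subset_closure hxs)⟩
    ⟨y, hyt, fun hc => hys (interior_subset (hfr y hyt hc))⟩
  exact hzc (subset_closure (interior_subset hzi))

/-- Extending by zero a function that is Lipschitz on `s` and vanishes on the frontier of `s`
preserves the Lipschitz constant. -/
theorem LipschitzOnWith.lipschitzWith_indicator {E F : Type*} [NormedAddCommGroup E]
    [NormedSpace ℝ E] [NormedAddCommGroup F] {s : Set E} {g : E → F} {K : NNReal}
    (hg : LipschitzOnWith K g s) (hs : IsClosed s) (h0 : ∀ x ∈ frontier s, g x = 0) :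
    LipschitzWith K (s.indicator g) := by
  have key : ∀ x ∈ s, ∀ y ∉ s, ‖g x‖ ≤ K * ‖x - y‖ := by
    intro x hx y hy
    obtain ⟨z, hz, hzs⟩ : (segment ℝ x y ∩ frontier s).Nonempty :=
      (convex_segment x y).isPreconnected.inter_frontier_nonempty
        ⟨x, left_mem_segment ℝ x y, hx⟩ ⟨y, right_mem_segment ℝ x y, hy⟩
    have h1 := hg.norm_sub_le hx (hs.frontier_subset hzs)
    rw [h0 z hzs, sub_zero] at h1
    have h2 : ‖x - z‖ ≤ ‖x - y‖ := by
      have := dist_add_dist_of_mem_segment hz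
      rw [dist_eq_norm, dist_eq_norm, dist_eq_norm] at this
      linarith [norm_nonneg (z - y)]
    exact h1.trans (by gcongr)
  refine lipschitzWith_iff_norm_sub_le.2 fun x y => ?_
  by_cases hx : x ∈ s <;> by_cases hy : y ∈ s
  · simpa [hx, hy] using hg.norm_sub_le hx hy
  · simpa [hx, hy] using key x hx y hy
  · simpa [hx, hy, norm_sub_rev x y] using key y hy x hx
  · simp only [hx, hy, not_false_eq_true, Set.indicator_of_notMem, sub_zero, norm_zero]
    positivity

/-- A contractive perturbation of the identity is bijective. -/
theorem LipschitzWith.bijective_id_add {E : Type*} [NormedAddCommGroup E] [NormedSpace ℝ E]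
    [CompleteSpace E] {g : E → E} {K : NNReal} (hg : LipschitzWith K g) (hK : K < 1) :
    Function.Bijective fun x => x + g x := by
  have happ : ApproximatesLinearOn (fun x => x + g x)
      (ContinuousLinearEquiv.refl ℝ E : E →L[ℝ] E) Set.univ K := by
    intro x _ y _
    change ‖x + g x - (y + g y) - (x - y)‖ ≤ K * ‖x - y‖
    rw [show x + g x - (y + g y) - (x - y) = g x - g y by abel]
    exact hg.norm_sub_le x y
  have hc : Subsingleton E ∨
      K < ‖((ContinuousLinearEquiv.refl ℝ E).symm : E →L[ℝ] E)‖₊⁻¹ := by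
    rcases subsingleton_or_nontrivial E with h | h
    · exact Or.inl h
    · right
      simpa using hK
  exact ⟨Set.injOn_univ.1 (happ.injOn hc), happ.surjective hc⟩

/-- The function `t ↦ det (1 + t A)` is a polynomial of degree at most the dimension. -/
theorem ContinuousLinearMap.exists_polynomial_det_one_add_smul {E : Type*}
    [NormedAddCommGroup E] [NormedSpace ℝ E] [FiniteDimensional ℝ E] (A : E →L[ℝ] E) :
    ∃ p : Polynomial ℝ, p.natDegree ≤ Module.finrank ℝ E ∧
      ∀ t : ℝ, p.eval t = (1 + t • A).det := by
  let b := Module.finBasis ℝ E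
  let M := LinearMap.toMatrix b b (A : E →ₗ[ℝ] E)
  refine ⟨((Polynomial.X : Polynomial ℝ) • M.map Polynomial.C +
    (1 : Matrix _ _ ℝ).map Polynomial.C).det, ?_, fun t => ?_⟩
  · simpa using Polynomial.natDegree_det_X_add_C_le M 1
  · rw [ContinuousLinearMap.det, ← LinearMap.det_toMatrix b, ContinuousLinearMap.toLinearMap_add,
      ContinuousLinearMap.toLinearMap_smul, map_add, map_smul, ← Polynomial.coe_evalRingHom,
      RingHom.map_det]
    congr 1
    ext i j
    have h1 : LinearMap.toMatrix b b ((1 : E →L[ℝ] E) : E →ₗ[ℝ] E) = 1 := LinearMap.toMatrix_one b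
    rw [h1]
    rcases eq_or_ne i j with rfl | hij
    · simp [M]
      ring
    · simp [M, Matrix.one_apply_ne hij]
      ring

/-- Extrapolation of determinants from the nodes `v i` to `1`. -/
theorem ContinuousLinearMap.det_one_add_eq_sum_lagrange {E : Type*}
    [NormedAddCommGroup E] [NormedSpace ℝ E] [FiniteDimensional ℝ E] {ι : Type*} [DecidableEq ι]
    {s : Finset ι} {v : ι → ℝ} (hv : Set.InjOn v s) (hs : Module.finrank ℝ E < s.card)
    (A : E →L[ℝ] E) :
    (1 + A).det = ∑ i ∈ s, (1 + v i • A).det * (Lagrange.basis s v i).eval 1 := by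
  obtain ⟨p, hp, hpt⟩ := A.exists_polynomial_det_one_add_smul
  have hdeg : p.degree < s.card :=
    Polynomial.degree_le_natDegree.trans_lt (by exact_mod_cast hp.trans_lt hs)
  have h := congrArg (Polynomial.eval 1) (Lagrange.eq_interpolate hv hdeg)
  rw [hpt, one_smul, Lagrange.interpolate_apply, Polynomial.eval_finsetSum] at h
  simpa [hpt] using h

section

variable {E : Type*} [NormedAddCommGroup E] [NormedSpace ℝ E] [FiniteDimensional ℝ E]
  [MeasurableSpace E] [BorelSpace E] (μ : Measure E) [μ.IsAddHaarMeasure]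
  {s : Set E} {g : E → E} {g' : E → E →L[ℝ] E}

/-- A small multiple of a `C¹` displacement vanishing on the frontier preserves volume. -/
theorem exists_pos_forall_setIntegral_det_one_add_smul_eq (hs : IsCompact s) (hconv : Convex ℝ s)
    (hg : ∀ x ∈ s, HasFDerivWithinAt g (g' x) s x) (hg' : ContinuousOn g' s)
    (h0 : ∀ x ∈ frontier s, g x = 0) :
    ∃ δ > 0, ∀ t : ℝ, 0 ≤ t → t < δ → ∫ x in s, (1 + t • g' x).det ∂μ = μ.real s := by
  obtain ⟨K, hK⟩ : ∃ K : NNReal, ∀ x ∈ s, ‖g' x‖₊ ≤ K := by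
    obtain ⟨C, hC⟩ := hs.exists_bound_of_continuousOn hg'
    exact ⟨C.toNNReal, fun x hx => NNReal.le_toNNReal_of_coe_le (hC x hx)⟩
  have hlip := (hconv.lipschitzOnWith_of_nnnorm_hasFDerivWithin_le hg hK).lipschitzWith_indicator
    hs.isClosed h0
  obtain ⟨ε, hε, hdet⟩ : ∃ ε > 0, ∀ A : E →L[ℝ] E, dist A 1 < ε → 0 < A.det := by
    have : ∀ᶠ A : E →L[ℝ] E in nhds 1, 0 < A.det :=
      ContinuousLinearMap.continuous_det.continuousAt.eventually_const_lt
        (by simp [ContinuousLinearMap.det])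
    exact Metric.eventually_nhds_iff.1 this
  refine ⟨min 1 ε / (K + 1), by positivity, fun t ht htδ => ?_⟩
  have htK : t * K < min 1 ε := by
    rw [lt_div_iff₀ (by positivity)] at htδ
    linarith
  have hbij : Function.Bijective fun x => x + t • s.indicator g x := by
    refine LipschitzWith.bijective_id_add (K := t.toNNReal * K)
      (LipschitzWith.of_dist_le_mul fun x y => ?_) ?_
    · rw [dist_smul₀, NNReal.coe_mul, Real.coe_toNNReal t ht, Real.norm_of_nonneg ht, mul_assoc]
      gcongr
      exact hlip.dist_le_mul x y
    · rw [← NNReal.coe_lt_coe, NNReal.coe_mul, Real.coe_toNNReal t ht]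
      exact htK.trans_le (min_le_left _ _)
  have heq : Set.EqOn (fun x => x + t • s.indicator g x) (fun x => x + t • g x) s := by
    intro x hx
    simp [hx]
  have himg : (fun x => x + t • g x) '' s = s := by
    rw [← heq.image_eq, ← compl_inj_iff, ← Set.image_compl_eq hbij]
    refine (Set.image_congr fun x hx => ?_).trans (Set.image_id _)
    simp [Set.indicator_of_notMem hx]
  have hinj : Set.InjOn (fun x => x + t • g x) s := heq.injOn_iff.1 hbij.1.injOn
  have hcov := integral_image_eq_integral_abs_det_fderiv_smul μ hs.measurableSet
    (fun x hx => (hasFDerivWithinAt_id x s).add ((hg x hx).const_smul t)) hinj fun _ => (1 : ℝ)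
  rw [show (id + t • g) '' s = s from himg] at hcov
  simp only [smul_eq_mul, mul_one, setIntegral_const] at hcov
  rw [hcov]
  refine setIntegral_congr_fun hs.measurableSet fun x hx => (abs_of_pos (hdet _ ?_)).symm
  rw [dist_eq_norm]
  change ‖(1 + t • g' x) - 1‖ < ε
  rw [add_sub_cancel_left, norm_smul, Real.norm_of_nonneg ht]
  have : ‖g' x‖ ≤ K := hK x hx
  calc t * ‖g' x‖ ≤ t * K := by gcongr
    _ < ε := htK.trans_le (min_le_right _ _)

/-- The Jacobian determinant of a `C¹` map which is the identity on the frontier of a compact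
convex set `s` integrates over `s` to the volume of `s`. -/
theorem setIntegral_det_one_add_eq (hs : IsCompact s) (hconv : Convex ℝ s)
    (hg : ∀ x ∈ s, HasFDerivWithinAt g (g' x) s x) (hg' : ContinuousOn g' s)
    (h0 : ∀ x ∈ frontier s, g x = 0) :
    ∫ x in s, (1 + g' x).det ∂μ = μ.real s := by
  obtain ⟨δ, hδ, hvol⟩ := exists_pos_forall_setIntegral_det_one_add_smul_eq μ hs hconv hg hg' h0
  let S := Finset.range (Module.finrank ℝ E + 1)
  let v : ℕ → ℝ := fun i => δ / (i + 2)
  have hv : Set.InjOn v S := by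
    intro i _ j _ hij
    have hi : (i : ℝ) + 2 ≠ 0 := by positivity
    have hj : (j : ℝ) + 2 ≠ 0 := by positivity
    simp only [v] at hij
    field_simp at hij
    exact_mod_cast (add_right_cancel hij).symm
  have hvδ : ∀ i, v i < δ := fun i => div_lt_self hδ (by linarith [Nat.cast_nonneg (α := ℝ) i])
  have hcont : ∀ t : ℝ, ContinuousOn (fun x => (1 + t • g' x).det) s := fun t =>
    ContinuousLinearMap.continuous_det.comp_continuousOn
      (continuousOn_const.add (hg'.const_smul t))
  calc ∫ x in s, (1 + g' x).det ∂μ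
      = ∫ x in s, ∑ i ∈ S, (1 + v i • g' x).det * (Lagrange.basis S v i).eval 1 ∂μ := by
        congr 1 with x
        exact (g' x).det_one_add_eq_sum_lagrange hv (by simp [S])
    _ = ∑ i ∈ S, μ.real s * (Lagrange.basis S v i).eval 1 := by
        rw [integral_finsetSum _ fun i _ =>
          ((hcont (v i)).integrableOn_compact hs).integrable.mul_const _]
        refine Finset.sum_congr rfl fun i _ => ?_
        rw [integral_mul_const, hvol (v i) (by positivity) (hvδ i)]
    _ = μ.real s := by
        rw [← Finset.mul_sum, ← Polynomial.eval_finsetSum, Lagrange.sum_basis hv (by simp [S]),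
          Polynomial.eval_one, mul_one]

end

/-- If `f : ℝⁿ → ℝⁿ` is `C²` on a neighborhood of the closed unit ball `B` and
fixes every point of the unit sphere, then `∫_B det(Df) = Vol(B)`. -/
theorem integral_jacobian_det_eq_volume_ball
    (n : ℕ) (hn : 1 ≤ n)
    (f : EuclideanSpace ℝ (Fin n) → EuclideanSpace ℝ (Fin n))
    (U : Set (EuclideanSpace ℝ (Fin n))) (hUopen : IsOpen U)
    (hBU : Metric.closedBall (0 : EuclideanSpace ℝ (Fin n)) 1 ⊆ U)
    (hf : ContDiffOn ℝ 2 f U)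
    (hbd : ∀ x ∈ Metric.sphere (0 : EuclideanSpace ℝ (Fin n)) 1, f x = x) :
    ∫ x in Metric.closedBall (0 : EuclideanSpace ℝ (Fin n)) 1, (fderiv ℝ f x).det ∂volume
      = (volume (Metric.closedBall (0 : EuclideanSpace ℝ (Fin n)) 1)).toReal := by
  have hball : ∀ x ∈ Metric.closedBall (0 : EuclideanSpace ℝ (Fin n)) 1, U ∈ nhds x :=
    fun x hx => hUopen.mem_nhds (hBU hx)
  have hfd : ∀ x ∈ Metric.closedBall (0 : EuclideanSpace ℝ (Fin n)) 1,
      HasFDerivAt f (fderiv ℝ f x) x := fun x hx =>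
    ((hf.contDiffAt (hball x hx)).differentiableAt (by norm_num)).hasFDerivAt
  have hmain := setIntegral_det_one_add_eq volume
    (isCompact_closedBall (0 : EuclideanSpace ℝ (Fin n)) 1) (convex_closedBall _ _)
    (g := fun x => f x - x) (g' := fun x => fderiv ℝ f x - 1)
    (fun x hx => ((hfd x hx).sub (hasFDerivAt_id x)).hasFDerivWithinAt)
    (((hf.continuousOn_fderiv_of_isOpen hUopen (by norm_num)).mono hBU).sub continuousOn_const)
    (fun x hx => by
      rw [frontier_closedBall _ one_ne_zero] at hx
      rw [hbd x hx, sub_self])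
  simpa only [add_sub_cancel, Measure.real] using hmain
end

section
/- Let n ≥ 2, let Ω ⊆ ℝⁿ be an open set, and let f², …, fⁿ : Ω → ℝ be C² functions. For each i ∈ {1, …, n} define Aᵢ(x) = (−1)^{i+1} · det M_i(x), where M_i(x) is the (n−1)×(n−1) matrix whose (k,l) entry is ∂f^{k+1}/∂x^{σ_i(l)}(x) and σ_i enumerates {1, …, n} \ {i} in increasing order (i.e., Aᵢ is, up to sign, the Jacobian minor ∂(f²,…,fⁿ)/∂(x¹,…,x̂ⁱ,…,xⁿ)). Then the vector field A = (A₁, …, Aₙ) is divergence-free on Ω: Σ_{i=1}^{n} ∂Aᵢ/∂xⁱ(x) = 0 for every x ∈ Ω (Jacobi's identity: the cofactors of one row of a Jacobian matrix of a C² map form a divergence-free vector field). -/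
/-- `exclEmb hn i : Fin (n-1) → Fin n` enumerates `{0, …, n-1} \ {i}` in
increasing order (the map `σ_i`, written here with 0-based indices). -/
def exclEmb {n : ℕ} (hn : 1 ≤ n) (i : Fin n) (l : Fin (n - 1)) : Fin n :=
  Fin.cast (Nat.succ_pred_eq_of_pos hn)
    (Fin.succAbove (Fin.cast (Nat.succ_pred_eq_of_pos hn).symm i) l)

namespace Matrix

/-- Replace one row of an `m × (m + 1)` matrix by the rows of a symmetric matrix in turn, each time
deleting the corresponding column: the alternating sum of the resulting minors vanishes. -/
theorem sum_neg_one_pow_mul_det_updateRow_submatrix_succAbove_eq_zero {R : Type*} [CommRing R]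
    {m : ℕ} (M : Matrix (Fin m) (Fin (m + 1)) R) {H : Matrix (Fin (m + 1)) (Fin (m + 1)) R}
    (hH : H.IsSymm) (k : Fin m) :
    ∑ i : Fin (m + 1), (-1) ^ (i : ℕ) * ((M.updateRow k (H i)).submatrix id i.succAbove).det = 0 := by
  obtain ⟨m, rfl⟩ : ∃ p, m = p + 1 := ⟨m - 1, by have := k.pos; omega⟩
  have expand (i : Fin (m + 2)) : ((M.updateRow k (H i)).submatrix id i.succAbove).det =
      ∑ j : Fin (m + 1), (-1) ^ (k + j : ℕ) * H i (i.succAbove j) *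
        (M.submatrix k.succAbove (i.succAbove ∘ j.succAbove)).det := by
    rw [det_succ_row _ k]
    refine Finset.sum_congr rfl fun j _ ↦ ?_
    congr 2
    · simp
    · ext
      simp
  simp only [expand, Finset.mul_sum, Fin.sum_sum_eq_sum_triangle_add]
  refine Finset.sum_eq_zero fun i _ ↦ Finset.sum_eq_zero fun j hj ↦ ?_
  rw [Finset.mem_Ici] at hj
  have hcols : i.castSucc.succAbove ∘ j.succAbove = j.succ.succAbove ∘ i.succAbove := by
    funext b
    simp only [Function.comp_apply, Fin.ext_iff, Fin.succAbove, Fin.lt_def, Fin.le_def] at hj ⊢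
    grind
  rw [Fin.succAbove_of_le_castSucc _ _ (by simpa using hj),
    Fin.succAbove_of_castSucc_lt _ _ (by simpa using hj),
    hcols, hH.apply]
  simp only [Fin.val_castSucc, Fin.val_succ]
  ring

/-- The determinant as a continuous multilinear map of the rows. -/
def detRowContinuousMultilinear (m 𝕜 : Type*) [Fintype m] [DecidableEq m] [CommRing 𝕜]
    [TopologicalSpace 𝕜] [IsTopologicalRing 𝕜] :
    ContinuousMultilinearMap 𝕜 (fun _ : m ↦ m → 𝕜) 𝕜 where
  toMultilinearMap := detRowAlternating.toMultilinearMap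
  cont := Continuous.matrix_det (A := fun M : Matrix m m 𝕜 ↦ M) continuous_id

end Matrix

/-- The derivative of a determinant is the sum of the determinants obtained by differentiating one
row at a time. -/
theorem HasFDerivAt.matrix_det {𝕜 E m : Type*} [NontriviallyNormedField 𝕜]
    [NormedAddCommGroup E] [NormedSpace 𝕜 E] [Fintype m] [DecidableEq m]
    {M : E → Matrix m m 𝕜} {M' : m → E →L[𝕜] (m → 𝕜)} {x : E}
    (hM : ∀ k, HasFDerivAt (fun y ↦ M y k) (M' k) x) :
    HasFDerivAt (fun y ↦ (M y).det)
      (∑ k, ((Matrix.detRowContinuousMultilinear m 𝕜).toContinuousLinearMap (M x) k) ∘L M' k) x :=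
  HasFDerivAt.multilinear_comp (f := Matrix.detRowContinuousMultilinear m 𝕜) hM

/-- Jacobi's identity: for `C²` functions `f², …, fⁿ` on an open set
`Ω ⊆ ℝⁿ` (`n ≥ 2`), the vector field `A = (A₁, …, Aₙ)` of signed `(n-1)×(n-1)`
minors `Aᵢ = (-1)^(i+1) ∂(f²,…,fⁿ)/∂(x¹,…,x̂ⁱ,…,xⁿ)` of the Jacobian of
`(f², …, fⁿ)` is divergence-free on `Ω`.  (Indices are 0-based in Lean: the
`k`-th function `f k` is `f^(k+2)`, the `i`-th coordinate `xⁱ` is `x^(i+1)`,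
so the sign `(-1)^(i+1)` becomes `(-1)^(i : ℕ)`.) -/
theorem divergence_of_jacobian_cofactors_eq_zero
    (n : ℕ) (hn : 2 ≤ n)
    (Ω : Set (Fin n → ℝ)) (hΩopen : IsOpen Ω)
    (f : Fin (n - 1) → (Fin n → ℝ) → ℝ)
    (hf : ∀ k, ContDiffOn ℝ 2 (f k) Ω)
    (A : Fin n → (Fin n → ℝ) → ℝ)
    (hA : ∀ i x, A i x =
      (-1 : ℝ) ^ (i : ℕ) *
        Matrix.det (Matrix.of fun k l : Fin (n - 1) =>
          fderiv ℝ (f k) x (Pi.single (exclEmb (by omega) i l) 1))) :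
    ∀ x ∈ Ω, ∑ i : Fin n, fderiv ℝ (A i) x (Pi.single i 1) = 0 := by
  obtain ⟨m, rfl⟩ : ∃ m, n = m + 1 := ⟨n - 1, by omega⟩
  intro x hx
  have hfx (k) : ContDiffAt ℝ 2 (f k) x := (hf k).contDiffAt (hΩopen.mem_nhds hx)
  have hd (k) : DifferentiableAt ℝ (fderiv ℝ (f k)) x :=
    ((hfx k).fderiv_right (m := 1) le_rfl).differentiableAt one_ne_zero
  let e (i : Fin (m + 1)) : Fin (m + 1) → ℝ := Pi.single i 1
  let J : Matrix (Fin m) (Fin (m + 1)) ℝ := .of fun k i ↦ fderiv ℝ (f k) x (e i)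
  let H (k : Fin m) : Matrix (Fin (m + 1)) (Fin (m + 1)) ℝ :=
    .of fun i j ↦ fderiv ℝ (fderiv ℝ (f k)) x (e i) (e j)
  have hH (k : Fin m) : (H k).IsSymm :=
    .ext fun i j ↦ (hfx k).isSymmSndFDerivAt (by simp) (e j) (e i)
  have hdA (i : Fin (m + 1)) : fderiv ℝ (A i) x (e i) =
      ∑ k, (-1) ^ (i : ℕ) * ((J.updateRow k (H k i)).submatrix id i.succAbove).det := by
    have hrow (k : Fin m) : HasFDerivAt (fun y l ↦ fderiv ℝ (f k) y (e (i.succAbove l)))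
        (.pi fun l ↦ (fderiv ℝ (fderiv ℝ (f k)) x).flip (e (i.succAbove l))) x :=
      hasFDerivAt_pi.2 fun l ↦ by
        simpa using (hd k).hasFDerivAt.clm_apply (hasFDerivAt_const (e (i.succAbove l)) x)
    have hAi : HasFDerivAt (A i) _ x :=
      ((HasFDerivAt.matrix_det (M := fun y ↦ .of fun k l ↦ fderiv ℝ (f k) y (e (i.succAbove l)))
        hrow).const_mul ((-1) ^ (i : ℕ))).congr_of_eventuallyEq (.of_forall (hA i))
    rw [hAi.fderiv, smul_apply, _root_.sum_apply, smul_eq_mul, Finset.mul_sum]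
    refine Finset.sum_congr rfl fun k _ ↦ congrArg _ ?_
    change (Matrix.updateRow _ k _).det = _
    congr 1
    ext a b
    rcases eq_or_ne a k with rfl | hak
    · simp [H]
    · simp [J, hak]
  calc
    _ = ∑ k, ∑ i : Fin (m + 1),
        (-1) ^ (i : ℕ) * ((J.updateRow k (H k i)).submatrix id i.succAbove).det := by
      rw [Finset.sum_comm]
      exact Finset.sum_congr rfl fun i _ ↦ hdA i
    _ = 0 := Finset.sum_eq_zero fun k _ ↦
      J.sum_neg_one_pow_mul_det_updateRow_submatrix_succAbove_eq_zero (hH k) k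
end

section
/- Let n ≥ 2, let Ω ⊆ ℝⁿ be an open set, and let f = (f¹, f², …, fⁿ) : Ω → ℝⁿ be a C² map. With Aᵢ(x) = (−1)^{i+1} ∂(f²,…,fⁿ)/∂(x¹,…,x̂ⁱ,…,xⁿ)(x) the signed minors of the Jacobian of (f²,…,fⁿ), the vector field x ↦ f¹(x)·A(x) satisfies div(f¹ A)(x) = Σ_{i=1}^{n} ∂(f¹ Aᵢ)/∂xⁱ(x) = det(Df(x)) for every x ∈ Ω. -/
/-- `succEmb hn k : Fin n` is the index `k + 1` (so `f (succEmb hn k)` ranges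
over the last `n-1` components `f², …, fⁿ` of an `n`-tuple, 0-based). -/
def succEmb {n : ℕ} (hn : 1 ≤ n) (k : Fin (n - 1)) : Fin n :=
  Fin.cast (Nat.succ_pred_eq_of_pos hn) k.succ

/-- The determinant of `m` vectors in `ℝᵐ`, as a continuous alternating form. -/
noncomputable def detForm (m : ℕ) : (Fin m → ℝ) [⋀^Fin m]→L[ℝ] ℝ :=
  { (Matrix.detRowAlternating : (Fin m → ℝ) [⋀^Fin m]→ₗ[ℝ] ℝ) with
    cont := Continuous.matrix_det (A := fun M : Matrix (Fin m) (Fin m) ℝ => M) continuous_id }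

lemma detForm_apply (m : ℕ) (v : Fin m → Fin m → ℝ) :
    detForm m v = Matrix.det (Matrix.of fun k l => v l k) :=
  (Matrix.det_transpose (Matrix.of v)).symm

/-- The minors of the Jacobian of `g : ℝᵐ⁺¹ → ℝᵐ` are differentiable where `g` is `C²`, and the
field of signed minors is divergence-free there. -/
lemma differentiableAt_minor_and_divergence_eq_zero {m : ℕ}
    {g : (Fin (m + 1) → ℝ) → Fin m → ℝ} {x : Fin (m + 1) → ℝ} (hg : ContDiffAt ℝ 2 g x) :
    (∀ i : Fin (m + 1), DifferentiableAt ℝ (fun y => Matrix.det (Matrix.of fun k l : Fin m =>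
        fderiv ℝ (fun z => g z k) y (Pi.single (i.succAbove l) 1))) x) ∧
      ∑ i : Fin (m + 1), (-1 : ℝ) ^ (i : ℕ) *
        fderiv ℝ (fun y => Matrix.det (Matrix.of fun k l : Fin m =>
          fderiv ℝ (fun z => g z k) y (Pi.single (i.succAbove l) 1))) x (Pi.single i 1) = 0 := by
  let ω : (Fin (m + 1) → ℝ) → (Fin (m + 1) → ℝ) [⋀^Fin m]→L[ℝ] ℝ :=
    fun y => (detForm m).compContinuousLinearMap (fderiv ℝ g y)
  let e : Fin (m + 1) → Fin (m + 1) → ℝ := fun j => Pi.single j 1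
  have hω : DifferentiableAt ℝ ω x :=
    (differentiableAt_const (detForm m)).continuousAlternatingMapCompContinuousLinearMap
      ((hg.fderiv_right (m := 1) (by norm_num)).differentiableAt (by norm_num))
  have hdω : extDeriv ω x = 0 := by
    have h := extDeriv_pullback (ω := fun _ => detForm m) (differentiableAt_const _) hg
      (by simp)
    refine h.trans ?_
    ext v
    simp [extDeriv_apply (differentiableAt_const (detForm m))]
  have heq (i : Fin (m + 1)) : (fun y => Matrix.det (Matrix.of fun k l : Fin m =>
      fderiv ℝ (fun z => g z k) y (Pi.single (i.succAbove l) 1))) =ᶠ[nhds x]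
      fun y => ω y (i.removeNth e) := by
    filter_upwards [hg.eventually (by simp)] with y hy
    have hy' := hy.differentiableAt (by norm_num)
    simp only [ω, ContinuousAlternatingMap.compContinuousLinearMap_apply, detForm_apply]
    congr 1
    ext k l
    simp only [Matrix.of_apply, Function.comp_apply]
    rw [fderiv_apply hy']
    rfl
  refine ⟨fun i => ?_, ?_⟩
  · refine DifferentiableAt.congr_of_eventuallyEq ?_ (heq i)
    fun_prop
  · have h := extDeriv_apply hω e
    rw [hdω] at h
    simp only [(heq _).fderiv_eq]
    simpa using h.symm


/-- For a `C²` map `f = (f¹, …, fⁿ) : Ω → ℝⁿ` (`n ≥ 2`) on an open set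
`Ω ⊆ ℝⁿ`, with `Aᵢ = (-1)^(i+1) ∂(f²,…,fⁿ)/∂(x¹,…,x̂ⁱ,…,xⁿ)` the signed minors
of the Jacobian of `(f², …, fⁿ)`, the divergence of the vector field `f¹ · A`
equals the Jacobian determinant of `f`:
`div (f¹ A)(x) = Σᵢ ∂(f¹ Aᵢ)/∂xⁱ (x) = det Df(x)` on `Ω`.
(Indices are 0-based in Lean, so the sign `(-1)^(i+1)` becomes `(-1)^(i : ℕ)`.) -/
theorem divergence_f1_cofactors_eq_jacobian_det
    (n : ℕ) (hn : 2 ≤ n)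
    (Ω : Set (Fin n → ℝ)) (hΩopen : IsOpen Ω)
    (f : (Fin n → ℝ) → Fin n → ℝ)
    (hf : ContDiffOn ℝ 2 f Ω)
    (A : Fin n → (Fin n → ℝ) → ℝ)
    (hA : ∀ i x, A i x =
      (-1 : ℝ) ^ (i : ℕ) *
        Matrix.det (Matrix.of fun k l : Fin (n - 1) =>
          fderiv ℝ (fun y => f y (succEmb (by omega) k)) x
            (Pi.single (exclEmb (by omega) i l) 1))) :
    ∀ x ∈ Ω,
      ∑ i : Fin n, fderiv ℝ (fun y => f y ⟨0, by omega⟩ * A i y) x (Pi.single i 1)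
        = Matrix.det (Matrix.of fun j i : Fin n =>
            fderiv ℝ (fun y => f y j) x (Pi.single i 1)) := by
  intro x hx
  obtain ⟨m, rfl⟩ : ∃ m, n = m + 1 := ⟨n - 1, by omega⟩
  have hfx : ContDiffAt ℝ 2 f x := hf.contDiffAt (hΩopen.mem_nhds hx)
  have hg : ContDiffAt ℝ 2 (fun y (k : Fin m) => f y k.succ) x :=
    contDiffAt_pi.2 fun k => contDiffAt_pi.1 hfx k.succ
  obtain ⟨hdiff, hdiv⟩ := differentiableAt_minor_and_divergence_eq_zero hg
  have hf0 : DifferentiableAt ℝ (fun y => f y 0) x :=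
    (contDiffAt_pi.1 hfx 0).differentiableAt (by norm_num)
  have hA' (i : Fin (m + 1)) : A i = fun y => (-1 : ℝ) ^ (i : ℕ) *
      Matrix.det (Matrix.of fun k l : Fin m =>
        fderiv ℝ (fun z => f z k.succ) y (Pi.single (i.succAbove l) 1)) :=
    funext fun y => hA i y
  have hterm (i : Fin (m + 1)) :
      fderiv ℝ (fun y => f y 0 * A i y) x (Pi.single i 1) =
        f x 0 * ((-1 : ℝ) ^ (i : ℕ) * fderiv ℝ (fun y => Matrix.det (Matrix.of fun k l : Fin m =>
          fderiv ℝ (fun z => f z k.succ) y (Pi.single (i.succAbove l) 1))) x (Pi.single i 1)) +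
        A i x * fderiv ℝ (fun y => f y 0) x (Pi.single i 1) := by
    have hAi : DifferentiableAt ℝ (A i) x := by
      rw [hA']
      exact (hdiff i).const_mul _
    rw [fderiv_fun_mul hf0 hAi, hA' i, fderiv_const_mul (hdiff i)]
    simp
  calc ∑ i : Fin (m + 1), fderiv ℝ (fun y => f y 0 * A i y) x (Pi.single i 1)
      = ∑ i : Fin (m + 1), A i x * fderiv ℝ (fun y => f y 0) x (Pi.single i 1) := by
        simp only [hterm, Finset.sum_add_distrib, ← Finset.mul_sum]
        rw [hdiv, mul_zero, zero_add]
    _ = _ := by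
        rw [Matrix.det_succ_row_zero]
        refine Finset.sum_congr rfl fun i _ => ?_
        rw [hA' i, mul_right_comm]
        rfl
end

section
/- Let n ≥ 1, let Ω ⊆ ℝⁿ be a bounded open set, let g, h : ℝⁿ → ℝ and f², …, fⁿ : ℝⁿ → ℝ be functions that are C² on an open neighborhood of the closure of Ω, and suppose g(x) = h(x) for every x in the topological boundary ∂Ω. Then ∫_Ω det J(g, f², …, fⁿ)(x) dx = ∫_Ω det J(h, f², …, fⁿ)(x) dx, where J(u¹, …, uⁿ)(x) denotes the n×n Jacobian matrix whose (j,i) entry is ∂uʲ/∂xⁱ(x). (In particular, the integral of the Jacobian determinant is unchanged when a single component is replaced by another one agreeing with it on ∂Ω.) -/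
open MeasureTheory

/-- The family `(g, f², …, fⁿ)` of `n` functions on `ℝⁿ`, obtained by
prepending `g` to the `n-1` functions `f k` (0-based indices). -/
def consFam {n : ℕ} (hn : 1 ≤ n) (g : (Fin n → ℝ) → ℝ)
    (f : Fin (n - 1) → (Fin n → ℝ) → ℝ) : Fin n → (Fin n → ℝ) → ℝ :=
  fun j => Fin.cases (motive := fun _ => (Fin n → ℝ) → ℝ) g f
    (Fin.cast (Nat.succ_pred_eq_of_pos hn).symm j)

/-- `jacobianDet u x` is the determinant of the `n × n` Jacobian matrix of the
functions `u 0, …, u (n-1)` at `x`, whose `(j, i)` entry is `∂uʲ/∂xⁱ (x)`. -/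
noncomputable def jacobianDet {n : ℕ} (u : Fin n → (Fin n → ℝ) → ℝ)
    (x : Fin n → ℝ) : ℝ :=
  Matrix.det (Matrix.of fun j i : Fin n => fderiv ℝ (u j) x (Pi.single i 1))

open Set Filter Topology

theorem ae_lineDeriv_eq_zero_of_eq_zero {E : Type*} [NormedAddCommGroup E] [NormedSpace ℝ E]
    [FiniteDimensional ℝ E] [MeasurableSpace E] [BorelSpace E] (μ : Measure E)
    [Measure.IsAddHaarMeasure μ] {f : E → ℝ} (hf : Continuous f) (v : E) :
    ∀ᵐ x ∂μ, f x = 0 → lineDeriv ℝ f x v = 0 := by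
  let L : ℝ →L[ℝ] E := ContinuousLinearMap.smulRight (1 : ℝ →L[ℝ] ℝ) v
  have hmeas : MeasurableSet {x | f x = 0 → lineDeriv ℝ f x v = 0} :=
    (hf.measurable (measurableSet_singleton 0)).imp
      (measurable_lineDeriv hf (measurableSet_singleton 0))
  refine ae_mem_of_ae_add_linearMap_mem L.toLinearMap volume μ hmeas fun y => ?_
  have hcount := countable_setOfPred_isolated_right_within (s := {t : ℝ | f (y + t • v) = 0})
  filter_upwards [hcount.ae_notMem volume] with t ht
  change f (y + t • v) = 0 → lineDeriv ℝ f (y + t • v) v = 0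
  intro h0
  by_contra hne
  have hderiv : lineDeriv ℝ f (y + t • v) v = deriv (fun s => f (y + s • v)) t := by
    have := deriv_comp_const_add (fun s => f (y + s • v)) t 0
    simp only [add_zero] at this
    rw [lineDeriv, ← this]
    simp only [add_smul, add_assoc]
  rw [hderiv] at hne
  have hd := (differentiableAt_of_deriv_ne_zero hne).hasDerivAt
  have hev : ∀ᶠ s in 𝓝[>] t, f (y + s • v) ≠ 0 :=
    (hd.eventually_ne hne).filter_mono (nhdsWithin_mono _ fun s hs => ne_of_gt hs)
  refine ht ⟨h0, ?_⟩
  rw [inter_comm, nhdsWithin_inter', inf_principal_eq_bot]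
  exact hev

theorem LipschitzWith.indicator_of_eq_zero_on_frontier {E F : Type*} [NormedAddCommGroup E]
    [NormedSpace ℝ E] [NormedAddCommGroup F] {f : E → F} {C : NNReal} (hf : LipschitzWith C f)
    {s : Set E} (h0 : ∀ x ∈ frontier s, f x = 0) : LipschitzWith C (s.indicator f) := by
  have key : ∀ x ∈ s, ∀ y ∉ s, dist (f x) 0 ≤ C * dist x y := by
    intro x hx y hy
    obtain ⟨z, hz, hzs⟩ : (segment ℝ x y ∩ frontier s).Nonempty := by
      by_contra hemp
      have hor : ∀ z ∈ segment ℝ x y, z ∈ interior s ∨ z ∉ closure s := fun z hz => by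
        by_contra! hcon
        exact hemp ⟨z, hz, hcon.2, hcon.1⟩
      obtain ⟨z, -, hz₁, hz₂⟩ := (convex_segment x y).isPreconnected (interior s) (closure s)ᶜ
        isOpen_interior isClosed_closure.isOpen_compl hor
        ⟨x, left_mem_segment ℝ x y, (hor x (left_mem_segment ℝ x y)).resolve_right
          fun h => h (subset_closure hx)⟩
        ⟨y, right_mem_segment ℝ x y, (hor y (right_mem_segment ℝ x y)).resolve_left
          fun h => hy (interior_subset h)⟩
      exact hz₂ (interior_subset_closure hz₁)
    rw [← h0 z hzs]
    refine (hf.dist_le_mul x z).trans ?_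
    gcongr
    have := dist_add_dist_of_mem_segment hz
    linarith [dist_nonneg (x := z) (y := y)]
  refine LipschitzWith.of_dist_le_mul fun x y => ?_
  by_cases hx : x ∈ s <;> by_cases hy : y ∈ s
  · simpa [hx, hy] using hf.dist_le_mul x y
  · simpa [hx, hy] using key x hx y hy
  · simpa [hx, hy, dist_comm] using key y hy x hx
  · simp only [hx, hy, not_false_eq_true, indicator_of_notMem, dist_self]; positivity

open Function in
theorem AlternatingMap.sum_update_single_update_eq_zero {ι κ R M : Type*} [Fintype ι]
    [DecidableEq ι] [DecidableEq κ] [CommRing R] [AddCommGroup M] [Module R M] [IsAddTorsionFree M]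
    (D : (ι → R) [⋀^κ]→ₗ[R] M) (m : κ → ι → R) {j k : κ} (hjk : j ≠ k)
    {H : ι → ι → R} (hH : ∀ i l, H i l = H l i) :
    ∑ i, D (update (update m j (Pi.single i 1)) k (H i)) = 0 := by
  have hexp : ∀ i, D (update (update m j (Pi.single i 1)) k (H i)) =
      ∑ l, H i l • D (update (update m j (Pi.single i 1)) k (Pi.single l 1)) := by
    intro i
    conv_lhs => rw [pi_eq_sum_univ' (H i)]
    simp only [D.map_update_sum, D.map_update_smul]
  have hswap : ∀ i l, D (update (update m j (Pi.single i 1)) k (Pi.single l 1)) =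
      -D (update (update m j (Pi.single l 1)) k (Pi.single i 1)) := by
    intro i l
    rw [← D.map_swap _ hjk]
    congr 1
    ext a b
    by_cases haj : a = j
    · subst haj; simp [hjk]
    by_cases hak : a = k
    · subst hak; simp [hjk]
    simp [haj, hak, Equiv.swap_apply_of_ne_of_ne]
  rw [← self_eq_neg]
  simp only [hexp]
  conv_lhs => rw [Finset.sum_comm]
  simp only [← Finset.sum_neg_distrib]
  refine Finset.sum_congr rfl fun l _ => Finset.sum_congr rfl fun i _ => ?_
  rw [hswap, hH, smul_neg]

theorem exists_contDiff_tsupport_subset_eq_one {E : Type*} [NormedAddCommGroup E]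
    [NormedSpace ℝ E] [FiniteDimensional ℝ E] {K U : Set E} (hK : IsCompact K) (hU : IsOpen U)
    (hKU : K ⊆ U) (n : ℕ∞) :
    ∃ χ : E → ℝ, ContDiff ℝ n χ ∧ HasCompactSupport χ ∧ tsupport χ ⊆ U ∧ ∀ x ∈ K, χ x = 1 := by
  obtain ⟨L, hL, hKL, hLU⟩ := exists_compact_between hK hU hKU
  obtain ⟨χ, hχ, -, hsupp, hone⟩ := exists_contMDiff_support_eq_eq_one_iff
    (modelWithCornersSelf ℝ E) (n := n) isOpen_interior hK.isClosed hKL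
  have hsub : tsupport χ ⊆ L :=
    closure_minimal (hsupp ▸ interior_subset) hL.isClosed
  exact ⟨χ, hχ.contDiff, hL.of_isClosed_subset (isClosed_tsupport χ) hsub, hsub.trans hLU,
    fun x hx => (hone x).1 hx⟩

theorem ContDiffOn.contDiff_mul_of_tsupport_subset {E : Type*} [NormedAddCommGroup E]
    [NormedSpace ℝ E] {χ u : E → ℝ} {U : Set E} {n : WithTop ℕ∞} (hu : ContDiffOn ℝ n u U)
    (hU : IsOpen U) (hχ : ContDiff ℝ n χ) (hsupp : tsupport χ ⊆ U) :
    ContDiff ℝ n fun x => χ x * u x := by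
  rw [contDiff_iff_contDiffAt]
  intro x
  by_cases hx : x ∈ tsupport χ
  · exact hχ.contDiffAt.mul (hu.contDiffAt (hU.mem_nhds (hsupp hx)))
  · have hev : (fun x => χ x * u x) =ᶠ[𝓝 x] fun _ => 0 := by
      filter_upwards [notMem_tsupport_iff_eventuallyEq.1 hx] with y hy
      simp [hy]
    exact contDiffAt_const.congr_of_eventuallyEq hev

/-- Divergence theorem for the product of a Lipschitz function vanishing on the boundary and a
divergence-free vector field, without any regularity of the boundary. -/
theorem setIntegral_sum_fderiv_mul_eq_zero {ι : Type*} [Fintype ι] {E : Type*}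
    [NormedAddCommGroup E] [NormedSpace ℝ E] [FiniteDimensional ℝ E] [MeasurableSpace E]
    [BorelSpace E] (μ : Measure E) [Measure.IsAddHaarMeasure μ] (v : ι → E)
    {Ω : Set E} (hΩo : IsOpen Ω) (hΩb : Bornology.IsBounded Ω)
    {w : E → ℝ} {C : NNReal} (hw : LipschitzWith C w) (hwd : Differentiable ℝ w)
    (hw0 : ∀ x ∈ frontier Ω, w x = 0) {A : ι → E → ℝ} (hA : ∀ i, ContDiff ℝ 1 (A i))
    (hdiv : ∀ x ∈ Ω, ∑ i, fderiv ℝ (A i) x (v i) = 0) :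
    ∫ x in Ω, ∑ i, fderiv ℝ w x (v i) * A i x ∂μ = 0 := by
  have hcpt : IsCompact (closure Ω) := hΩb.isCompact_closure
  obtain ⟨χ, hχ, hχc, -, hχ1⟩ :=
    exists_contDiff_tsupport_subset_eq_one hcpt isOpen_univ (subset_univ _) 1
  set W := Ω.indicator w
  have hW : LipschitzWith C W := hw.indicator_of_eq_zero_on_frontier hw0
  have hWc : HasCompactSupport W :=
    HasCompactSupport.intro hcpt fun x hx => indicator_of_notMem (fun h => hx (subset_closure h)) _
  set B : ι → E → ℝ := fun i x => χ x * A i x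
  have hB : ∀ i, ContDiff ℝ 1 (B i) := fun i => hχ.mul (hA i)
  have hBc : ∀ i, HasCompactSupport (B i) := fun i => hχc.mul_right
  have hBL : ∀ i, ∃ D, LipschitzWith D (B i) := fun i =>
    (hB i).lipschitzWith_of_hasCompactSupport (hBc i) one_ne_zero
  choose D hD using hBL
  have hWB : ∀ i, Integrable (fun x => lineDeriv ℝ W x (v i) * B i x) μ := fun i =>
    ((hB i).continuous.integrable_of_hasCompactSupport (hBc i)).mul_of_top_right
      (hW.memLp_lineDeriv (v i))
  have hBW : ∀ i, Integrable (fun x => lineDeriv ℝ (B i) x (-v i) * W x) μ := fun i =>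
    (hW.continuous.integrable_of_hasCompactSupport hWc).mul_of_top_right
      ((hD i).memLp_lineDeriv (-v i))
  have hzero : ∀ᵐ x ∂μ, ∀ i, W x = 0 → lineDeriv ℝ W x (v i) = 0 :=
    ae_all_iff.2 fun i => ae_lineDeriv_eq_zero_of_eq_zero μ hW.continuous (v i)
  calc ∫ x in Ω, ∑ i, fderiv ℝ w x (v i) * A i x ∂μ
      = ∫ x, ∑ i, lineDeriv ℝ W x (v i) * B i x ∂μ := by
        rw [← integral_indicator hΩo.measurableSet]
        refine integral_congr_ae ?_
        filter_upwards [hzero] with x hx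
        by_cases hxΩ : x ∈ Ω
        · rw [indicator_of_mem hxΩ]
          refine Finset.sum_congr rfl fun i _ => ?_
          have hev : W =ᶠ[𝓝 x] w := by
            filter_upwards [hΩo.mem_nhds hxΩ] with y hy using indicator_of_mem hy _
          rw [hev.lineDeriv_eq, (hwd x).lineDeriv_eq_fderiv]
          simp [B, hχ1 x (subset_closure hxΩ)]
        · rw [indicator_of_notMem hxΩ]
          exact (Finset.sum_eq_zero fun i _ => by
            rw [hx i (indicator_of_notMem hxΩ _), zero_mul]).symm
    _ = ∑ i, ∫ x, lineDeriv ℝ (B i) x (-v i) * W x ∂μ := by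
        rw [integral_finsetSum _ fun i _ => hWB i]
        exact Finset.sum_congr rfl fun i _ => hW.integral_lineDeriv_mul_eq (hD i) (hBc i) (v i)
    _ = ∫ x, ∑ i, lineDeriv ℝ (B i) x (-v i) * W x ∂μ :=
        (integral_finsetSum _ fun i _ => hBW i).symm
    _ = 0 := by
        refine integral_eq_zero_of_ae (Eventually.of_forall fun x => ?_)
        change ∑ i, lineDeriv ℝ (B i) x (-v i) * W x = 0
        by_cases hxΩ : x ∈ Ω
        · rw [← Finset.sum_mul]
          have hev : ∀ i, B i =ᶠ[𝓝 x] A i := fun i => by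
            filter_upwards [hΩo.mem_nhds hxΩ] with y hy
            simp [B, hχ1 y (subset_closure hy)]
          have : ∀ i, lineDeriv ℝ (B i) x (-v i) = -fderiv ℝ (A i) x (v i) := fun i => by
            rw [(hev i).lineDeriv_eq,
              ((hA i).differentiable one_ne_zero x).lineDeriv_eq_fderiv, map_neg]
          simp [this, hdiv x hxΩ]
        · simp [W, hxΩ]

/-- The determinant as a continuous multilinear function of the rows of a matrix. -/
noncomputable def detRowContinuousMultilinear (ι : Type*) [Fintype ι] [DecidableEq ι] :
    ContinuousMultilinearMap ℝ (fun _ : ι => ι → ℝ) ℝ where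
  toMultilinearMap := (Matrix.detRowAlternating (n := ι) (R := ℝ)).toMultilinearMap
  cont := Continuous.matrix_det (A := fun m : ι → ι → ℝ => Matrix.of m) continuous_id

/-- The gradient of `u` in coordinates. -/
noncomputable def coordGradient {ι : Type*} [Fintype ι] [DecidableEq ι] (u : (ι → ℝ) → ℝ)
    (x : ι → ℝ) : ι → ℝ :=
  fun i => fderiv ℝ u x (Pi.single i 1)

theorem ContDiff.coordGradient {ι : Type*} [Fintype ι] [DecidableEq ι] {u : (ι → ℝ) → ℝ}
    {m n : WithTop ℕ∞} (hu : ContDiff ℝ n u) (hmn : m + 1 ≤ n) :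
    ContDiff ℝ m (coordGradient u) :=
  contDiff_pi.2 fun _ => (hu.fderiv_right hmn).clm_apply contDiff_const

open Function in
/-- The cofactors of a row of a Jacobian matrix form a divergence-free vector field. -/
theorem sum_fderiv_det_update_coordGradient_eq_zero {ι : Type*} [Fintype ι] [DecidableEq ι]
    {u : ι → (ι → ℝ) → ℝ} (hu : ∀ k, ContDiff ℝ 2 (u k)) (j : ι) (x : ι → ℝ) :
    ∑ i, fderiv ℝ (fun y => detRowContinuousMultilinear ι
      (update (fun k => coordGradient (u k) y) j (Pi.single i 1))) x (Pi.single i 1) = 0 := by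
  set D := detRowContinuousMultilinear ι
  set G : ι → (ι → ℝ) → ι → ℝ := fun k => coordGradient (u k)
  have hG : ∀ k, HasFDerivAt (G k) (fderiv ℝ (G k) x) x := fun k =>
    (((hu k).coordGradient (m := 1) (by norm_num)).differentiable one_ne_zero x).hasFDerivAt
  have hGapply : ∀ k i l, fderiv ℝ (G k) x (Pi.single i 1) l =
      fderiv ℝ (fderiv ℝ (u k)) x (Pi.single i 1) (Pi.single l 1) := by
    intro k i l
    have h1 : HasFDerivAt (fun y => G k y l) _ x := hasFDerivAt_pi'.1 (hG k) l
    have h2 : DifferentiableAt ℝ (fderiv ℝ (u k)) x :=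
      ((hu k).fderiv_right (m := 1) (by norm_num)).differentiable one_ne_zero x
    have h3 := h2.hasFDerivAt.clm_apply (hasFDerivAt_const (Pi.single l (1 : ℝ) : ι → ℝ) x)
    have := congrArg (fun T => T (Pi.single i (1 : ℝ))) (h1.unique h3)
    simpa using this
  let H : ι → ι → ι → ℝ := fun k i => fderiv ℝ (G k) x (Pi.single i 1)
  have hH : ∀ k i l, H k i l = H k l i := by
    intro k i l
    simp only [H, hGapply]
    exact ((hu k).contDiffAt.isSymmSndFDerivAt (by simp)) _ _
  have hderiv : ∀ i, fderiv ℝ (fun y => D (update (fun k => G k y) j (Pi.single i 1))) x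
      (Pi.single i 1) = ∑ k ∈ Finset.univ.erase j,
        D (update (update (fun k => G k x) j (Pi.single i 1)) k (H k i)) := by
    intro i
    have hrow : ∀ k, HasFDerivAt (fun y => update (fun k => G k y) j (Pi.single i 1) k)
        (if k = j then 0 else fderiv ℝ (G k) x) x := by
      intro k
      split_ifs with hk
      · subst hk; simpa using hasFDerivAt_const (𝕜 := ℝ) (Pi.single i (1 : ℝ) : ι → ℝ) x
      · simpa [hk] using hG k
    rw [(HasFDerivAt.multilinear_comp (f := D) hrow).fderiv]
    simp only [_root_.sum_apply, ContinuousLinearMap.comp_apply,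
      ContinuousMultilinearMap.toContinuousLinearMap_apply]
    rw [← Finset.add_sum_erase _ _ (Finset.mem_univ j)]
    rw [D.map_coord_zero j (by simp), zero_add]
    refine Finset.sum_congr rfl fun k hk => ?_
    rw [if_neg (Finset.ne_of_mem_erase hk)]
  rw [Finset.sum_congr rfl fun i _ => hderiv i, Finset.sum_comm]
  refine Finset.sum_eq_zero fun k hk => ?_
  exact AlternatingMap.sum_update_single_update_eq_zero Matrix.detRowAlternating
    (fun k => G k x) (Finset.ne_of_mem_erase hk).symm (hH k)

open Function in
theorem setIntegral_det_coordGradient_eq_zero {ι : Type*} [Fintype ι] [DecidableEq ι]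
    {Ω : Set (ι → ℝ)} (hΩo : IsOpen Ω) (hΩb : Bornology.IsBounded Ω)
    {u : ι → (ι → ℝ) → ℝ} (hu : ∀ k, ContDiff ℝ 2 (u k)) {j : ι}
    (huc : HasCompactSupport (u j)) (hu0 : ∀ x ∈ frontier Ω, u j x = 0) :
    ∫ x in Ω, detRowContinuousMultilinear ι (fun k => coordGradient (u k) x) = 0 := by
  set D := detRowContinuousMultilinear ι
  obtain ⟨C, hC⟩ := (hu j).lipschitzWith_of_hasCompactSupport huc two_ne_zero
  have hA : ∀ i : ι, ContDiff ℝ 1 fun y =>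
      D (update (fun k => coordGradient (u k) y) j (Pi.single i 1)) := by
    intro i
    refine D.contDiff.comp (contDiff_pi.2 fun k => ?_)
    rcases eq_or_ne k j with rfl | hk
    · simpa using contDiff_const
    · simpa [hk] using (hu k).coordGradient (by norm_num)
  rw [← setIntegral_sum_fderiv_mul_eq_zero volume (fun i : ι => Pi.single i (1 : ℝ)) hΩo hΩb hC
    ((hu j).differentiable two_ne_zero) hu0 hA
    fun x _ => sum_fderiv_det_update_coordGradient_eq_zero hu j x]
  refine integral_congr_ae (Eventually.of_forall fun x => ?_)
  have hrow : (fun k => coordGradient (u k) x) = update (fun k => coordGradient (u k) x) j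
      (∑ i, coordGradient (u j) x i • Pi.single i (1 : ℝ)) := by
    rw [← pi_eq_sum_univ' (coordGradient (u j) x), update_eq_self_iff.2 rfl]
  change D (fun k => coordGradient (u k) x) = _
  rw [hrow]
  refine (D.toMultilinearMap.map_update_sum ..).trans (Finset.sum_congr rfl fun i _ => ?_)
  exact D.map_update_smul ..

open Function in
theorem setIntegral_det_coordGradient_update {ι : Type*} [Fintype ι] [DecidableEq ι]
    {Ω : Set (ι → ℝ)} (hΩo : IsOpen Ω) (hΩb : Bornology.IsBounded Ω)
    {u : ι → (ι → ℝ) → ℝ} (hu : ∀ k, ContDiff ℝ 2 (u k)) {j : ι}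
    (huc : HasCompactSupport (u j)) {g : (ι → ℝ) → ℝ} (hg : ContDiff ℝ 2 g)
    (hgc : HasCompactSupport g) (hgu : ∀ x ∈ frontier Ω, g x = u j x) :
    ∫ x in Ω, detRowContinuousMultilinear ι (fun k => coordGradient (update u j g k) x) =
      ∫ x in Ω, detRowContinuousMultilinear ι (fun k => coordGradient (u k) x) := by
  set D := detRowContinuousMultilinear ι
  have hint : ∀ {v : ι → (ι → ℝ) → ℝ}, (∀ k, ContDiff ℝ 2 (v k)) →
      IntegrableOn (fun x => D (fun k => coordGradient (v k) x)) Ω := fun hv =>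
    ((D.cont.comp (continuous_pi fun k => ((hv k).coordGradient (m := 0)
      (by norm_num)).continuous)).continuousOn.integrableOn_compact
        hΩb.isCompact_closure).mono_set subset_closure
  have hup : ∀ {w : (ι → ℝ) → ℝ}, ContDiff ℝ 2 w → ∀ k, ContDiff ℝ 2 (update u j w k) := by
    intro w hw k
    rcases eq_or_ne k j with rfl | hk
    · simpa using hw
    · simpa [hk] using hu k
  have hrow : ∀ w x, (fun k => coordGradient (update u j w k) x) =
      update (fun k => coordGradient (u k) x) j (coordGradient w x) := fun w x =>
    funext fun k => apply_update (fun _ v => coordGradient v x) u j w k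
  have hzero := setIntegral_det_coordGradient_eq_zero hΩo hΩb (hup (hg.sub (hu j))) (j := j)
    (by rw [update_self]; exact hgc.sub huc) (fun x hx => by simp [hgu x hx])
  rw [← sub_eq_zero, ← integral_sub (hint (hup hg)) (hint hu), ← hzero]
  refine integral_congr_ae (Eventually.of_forall fun x => ?_)
  have hsub : coordGradient (g - u j) x = coordGradient g x - coordGradient (u j) x := by
    ext i
    simp only [coordGradient, Pi.sub_apply]
    rw [fderiv_sub (hg.differentiable two_ne_zero x) ((hu j).differentiable two_ne_zero x)]
    rfl
  change D (fun k => coordGradient (update u j g k) x) - D (fun k => coordGradient (u k) x) =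
    D (fun k => coordGradient (update u j (g - u j) k) x)
  rw [hrow, hrow, hsub, D.map_update_sub, update_eq_self_iff.2 rfl]

theorem consFam_eq_update {n : ℕ} (hn : 1 ≤ n) (g h : (Fin n → ℝ) → ℝ)
    (f : Fin (n - 1) → (Fin n → ℝ) → ℝ) :
    consFam hn g f = Function.update (consFam hn h f) ⟨0, hn⟩ g := by
  obtain ⟨n, rfl⟩ : ∃ m, n = m + 1 := ⟨n - 1, by omega⟩
  ext k x
  refine Fin.cases ?_ (fun i => ?_) k
  · rfl
  · rw [Function.update_of_ne (by simp [Fin.ext_iff])]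
    rfl

theorem forall_consFam {n : ℕ} (hn : 1 ≤ n) {g : (Fin n → ℝ) → ℝ}
    {f : Fin (n - 1) → (Fin n → ℝ) → ℝ} {P : ((Fin n → ℝ) → ℝ) → Prop} (hg : P g)
    (hf : ∀ k, P (f k)) (k : Fin n) : P (consFam hn g f k) := by
  obtain ⟨n, rfl⟩ : ∃ m, n = m + 1 := ⟨n - 1, by omega⟩
  exact Fin.cases hg hf k

/-- Replacing one component of a map by another one agreeing with it on the
boundary does not change the integral of the Jacobian determinant:
if `g, h, f², …, fⁿ` are `C²` on a neighborhood of the closure of a bounded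
open set `Ω ⊆ ℝⁿ` and `g = h` on `∂Ω`, then
`∫_Ω det J(g, f², …, fⁿ) = ∫_Ω det J(h, f², …, fⁿ)`. -/
theorem integral_jacobian_det_replace_component
    (n : ℕ) (hn : 1 ≤ n)
    (Ω : Set (Fin n → ℝ)) (hΩopen : IsOpen Ω) (hΩbdd : Bornology.IsBounded Ω)
    (g h : (Fin n → ℝ) → ℝ) (f : Fin (n - 1) → (Fin n → ℝ) → ℝ)
    (U : Set (Fin n → ℝ)) (hUopen : IsOpen U) (hΩU : closure Ω ⊆ U)
    (hg : ContDiffOn ℝ 2 g U) (hh : ContDiffOn ℝ 2 h U)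
    (hf : ∀ k, ContDiffOn ℝ 2 (f k) U)
    (hbd : ∀ x ∈ frontier Ω, g x = h x) :
    ∫ x in Ω, jacobianDet (consFam hn g f) x ∂volume
      = ∫ x in Ω, jacobianDet (consFam hn h f) x ∂volume := by
  obtain ⟨χ, hχ, hχc, hχU, hχ1⟩ :=
    exists_contDiff_tsupport_subset_eq_one hΩbdd.isCompact_closure hUopen hΩU 2
  have hsmooth : ∀ v, ContDiffOn ℝ 2 v U → ContDiff ℝ 2 fun x => χ x * v x := fun v hv =>
    hv.contDiff_mul_of_tsupport_subset hUopen hχ hχU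
  have hcut : ∀ v : Fin n → (Fin n → ℝ) → ℝ, ∫ x in Ω, jacobianDet v x =
      ∫ x in Ω, detRowContinuousMultilinear (Fin n)
        (fun k => coordGradient (fun x => χ x * v k x) x) := by
    intro v
    refine setIntegral_congr_fun hΩopen.measurableSet fun x hx => ?_
    have hrow : ∀ k, coordGradient (fun x => χ x * v k x) x = coordGradient (v k) x := by
      intro k
      have hev : (fun x => χ x * v k x) =ᶠ[𝓝 x] v k := by
        filter_upwards [hΩopen.mem_nhds hx] with y hy
        rw [hχ1 y (subset_closure hy), one_mul]
      ext i
      rw [coordGradient, coordGradient, hev.fderiv_eq]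
    simp only [hrow]
    rfl
  have hupd : (fun k x => χ x * consFam hn g f k x) = Function.update
      (fun k x => χ x * consFam hn h f k x) ⟨0, hn⟩ (fun x => χ x * g x) := by
    rw [consFam_eq_update hn g h f]
    exact funext fun k => Function.apply_update (fun _ (v : (Fin n → ℝ) → ℝ) x => χ x * v x) _ _ _ k
  have key := setIntegral_det_coordGradient_update hΩopen hΩbdd (j := ⟨0, hn⟩)
    (u := fun k x => χ x * consFam hn h f k x) (fun k => hsmooth _ (forall_consFam hn (P := fun v => ContDiffOn ℝ 2 v U) hh hf k))
    hχc.mul_right (hsmooth g hg) hχc.mul_right fun x hx => by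
      rw [hbd x hx]
      rfl
  rw [← hupd] at key
  rw [hcut, hcut, key]
end
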